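/- Under the stated hypotheses, for every z ∈ S the limit lim_{t→∞} ∫_0^t ( φ(x(s)) − φ(z) + (1 − k/γ) β(s) ψ(x(s)) ) ds exists and is a real number. -/

import Mathlib

open Filter MeasureTheory Set RealInnerProductSpace

theorem ConvexOn.inner_gradient_le {H : Type*} [NormedAddCommGroup H] [InnerProductSpace ℝ H]
    [CompleteSpace H] {f : H → ℝ} (hf : ConvexOn ℝ univ f) (hd : Differentiable ℝ f) (a b : H) :
    ⟪gradient f a, b - a⟫ ≤ f b - f a := by
  have hc : ConvexOn ℝ univ (f ∘ AffineMap.lineMap (k := ℝ) a b) := by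
    simpa using hf.comp_affineMap (AffineMap.lineMap (k := ℝ) a b)
  have hda : HasFDerivAt f (fderiv ℝ f a) (AffineMap.lineMap (k := ℝ) a b (0 : ℝ)) := by
    simpa using (hd a).hasFDerivAt
  have hderiv := hda.comp_hasDerivAt (0 : ℝ) (AffineMap.hasDerivAt_lineMap (a := a) (b := b))
  have h := hc.le_slope_of_hasDerivAt (mem_univ 0) (mem_univ 1) one_pos hderiv
  rw [inner_gradient_left]
  simpa [slope_def_field] using h

theorem IsMinOn.inner_gradient_nonneg {H : Type*} [NormedAddCommGroup H] [InnerProductSpace ℝ H]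
    [CompleteSpace H] {f : H → ℝ} {s : Set H} {a b : H} (hmin : IsMinOn f s a)
    (hs : Convex ℝ s) (hd : DifferentiableAt ℝ f a) (ha : a ∈ s) (hb : b ∈ s) :
    0 ≤ ⟪gradient f a, b - a⟫ := by
  rw [inner_gradient_left]
  exact hmin.localize.hasFDerivWithinAt_nonneg hd.hasFDerivAt.hasFDerivWithinAt
    (sub_mem_posTangentConeAt_of_segment_subset (hs.segment_subset ha hb))

theorem HasDerivWithinAt.comp_gradient {H : Type*} [NormedAddCommGroup H] [InnerProductSpace ℝ H]
    [CompleteSpace H] {f : H → ℝ} {x : ℝ → H} {x' : H} {s : Set ℝ} {t : ℝ}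
    (hx : HasDerivWithinAt x x' s t) (hf : DifferentiableAt ℝ f (x t)) :
    HasDerivWithinAt (fun r => f (x r)) ⟪gradient f (x t), x'⟫ s t := by
  rw [inner_gradient_left]
  exact hf.hasFDerivAt.comp_hasDerivWithinAt t hx

/-- If the integral of the negative part of `f` is finite and the primitive of `f` is dominated by
`C - u'` for a nonnegative function `u`, then `f` is integrable on the half-line. -/
theorem integrableOn_Ioi_of_deriv_add_integral_le {f u u' : ℝ → ℝ} {C : ℝ} (hf : Continuous f)
    (hneg : ∫⁻ t in Ici (0 : ℝ), ENNReal.ofReal (-f t) ≠ ⊤)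
    (hu : ∀ t ∈ Ici (0 : ℝ), HasDerivWithinAt u (u' t) (Ici 0) t)
    (hu0 : ∀ t ∈ Ici (0 : ℝ), 0 ≤ u t)
    (hC : ∀ t ∈ Ici (0 : ℝ), u' t + ∫ s in (0 : ℝ)..t, f s ≤ C) :
    IntegrableOn f (Ioi 0) := by
  set n : ℝ → ℝ := fun t => max (-f t) 0 with hn
  have hnc : Continuous n := by fun_prop
  have hn0 : ∀ t, 0 ≤ n t := fun t => le_max_right _ _
  have hni : IntegrableOn n (Ioi 0) := by
    refine IntegrableOn.mono_set (t := Ici 0) ⟨hnc.aestronglyMeasurable, ?_⟩ Ioi_subset_Ici_self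
    rw [hasFiniteIntegral_iff_ofReal (Eventually.of_forall hn0), lt_top_iff_ne_top]
    simpa [hn, ENNReal.ofReal_max] using hneg
  set N : ℝ := ∫ t in Ioi 0, n t with hN
  have hnN : ∀ t, 0 ≤ t → ∫ s in (0 : ℝ)..t, n s ≤ N := fun t ht => by
    rw [intervalIntegral.integral_of_le ht]
    exact setIntegral_mono_set hni (Eventually.of_forall hn0)
      (Eventually.of_forall Ioc_subset_Ioi_self)
  have habs : ∀ t, ∫ s in (0 : ℝ)..t, ‖f s‖ =
      (∫ s in (0 : ℝ)..t, f s) + 2 * ∫ s in (0 : ℝ)..t, n s := fun t => by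
    rw [← intervalIntegral.integral_const_mul, ← intervalIntegral.integral_add
      (hf.intervalIntegrable _ _) ((hnc.const_mul 2).intervalIntegrable _ _)]
    refine intervalIntegral.integral_congr fun s _ => ?_
    simp only [hn, Real.norm_eq_abs]
    rcases le_total 0 (f s) with h | h
    · rw [abs_of_nonneg h, max_eq_right (by linarith)]; ring
    · rw [abs_of_nonpos h, max_eq_left (by linarith)]; ring
  refine integrableOn_Ioi_of_intervalIntegral_norm_bounded (C + 2 * N + 1) 0
    (fun i => hf.integrableOn_Ioc) tendsto_id ?_
  filter_upwards [eventually_ge_atTop 0] with t₀ ht₀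
  by_contra! hlt
  have hu' : ∀ t, t₀ ≤ t → u' t ≤ -1 := fun t ht => by
    have h1 : ∫ s in (0 : ℝ)..t₀, ‖f s‖ ≤ ∫ s in (0 : ℝ)..t, ‖f s‖ :=
      intervalIntegral.integral_mono_interval le_rfl ht₀ ht
        (Eventually.of_forall fun s => norm_nonneg _) (hf.norm.intervalIntegrable _ _)
    have h2 := hC t (ht₀.trans ht)
    have h3 := hnN t (ht₀.trans ht)
    have h4 := habs t
    simp only [id] at hlt
    linarith
  have hsub : Ici t₀ ⊆ Ici 0 := Ici_subset_Ici.2 ht₀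
  have hv : ∀ t ∈ Ici t₀, HasDerivWithinAt (fun r => u r + r) (u' t + 1) (Ici t₀) t := fun t ht =>
    ((hu t (hsub ht)).mono hsub).add (hasDerivWithinAt_id t _)
  have hanti : AntitoneOn (fun r => u r + r) (Ici t₀) := by
    refine antitoneOn_of_hasDerivWithinAt_nonpos (f' := fun t => u' t + 1) (convex_Ici t₀)
      (fun t ht => (hv t ht).continuousWithinAt)
      (fun t ht => (hv t (interior_subset ht)).mono interior_subset) fun t ht => ?_
    have := hu' t (interior_subset ht)
    linarith
  have hut := hu0 t₀ ht₀
  have hle : t₀ ≤ t₀ + u t₀ + 1 := by linarith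
  have h1 := hanti self_mem_Ici (mem_Ici.2 hle) hle
  have h2 := hu0 (t₀ + u t₀ + 1) (ht₀.trans hle)
  simp only at h1
  linarith

theorem stmt6 {H : Type*} [NormedAddCommGroup H] [InnerProductSpace ℝ H] [CompleteSpace H]
    (φ ψ : H → ℝ) (γ k : ℝ) (β β' : ℝ → ℝ) (x x' x'' : ℝ → H)
    -- ψ is convex, Fréchet differentiable with Lipschitz continuous gradient,
    -- nonnegative, and argmin ψ = ψ⁻¹(0) is nonempty
    (hψconv : ConvexOn ℝ univ ψ)
    (hψdiff : Differentiable ℝ ψ)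
    (hψlip : ∃ L : NNReal, LipschitzWith L (gradient ψ))
    (hψnonneg : ∀ y, 0 ≤ ψ y)
    (hψmin : ∃ y, ψ y = 0)
    -- φ is convex, Fréchet differentiable with Lipschitz continuous gradient,
    -- bounded from below, and S = {z ∈ argmin ψ : φ z ≤ φ y ∀ y ∈ argmin ψ} is nonempty
    (hφconv : ConvexOn ℝ univ φ)
    (hφdiff : Differentiable ℝ φ)
    (hφlip : ∃ L : NNReal, LipschitzWith L (gradient φ))
    (hφbdd : BddBelow (range φ))
    (hS : ∃ z : H, ψ z = 0 ∧ ∀ y, ψ y = 0 → φ z ≤ φ y)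
    -- γ > 0, 0 ≤ k < γ, and β : [0,∞) → (0,∞) is a C¹ function (with derivative β')
    -- satisfying the growth condition 0 ≤ β' ≤ k β
    (hγ : 0 < γ) (hk : 0 ≤ k) (hkγ : k < γ)
    (hβpos : ∀ t ∈ Ici (0 : ℝ), 0 < β t)
    (hβderiv : ∀ t ∈ Ici (0 : ℝ), HasDerivWithinAt β (β' t) (Ici 0) t)
    (hβ'cont : ContinuousOn β' (Ici 0))
    (hβgrowth : ∀ t ∈ Ici (0 : ℝ), 0 ≤ β' t ∧ β' t ≤ k * β t)
    -- condition (H): for every p in the range of the normal cone to argmin ψ (i.e.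
    -- p ∈ N(z) for some z ∈ argmin ψ = ψ⁻¹(0)), the integral
    -- ∫_0^∞ β(t) [ψ*(p/β(t)) - σ(p/β(t))] dt is finite; here σ(p/β(t)) = ⟪p/β(t), z⟫
    -- since p ∈ N(z), and β(t)[ψ*(q) - ⟪q, z⟫] = ⨆ w, β(t)((⟪q, w⟫ - ψ w) - ⟪q, z⟫) ≥ 0.
    (hH : ∀ z p : H, ψ z = 0 → (∀ y, ψ y = 0 → ⟪p, y - z⟫ ≤ 0) →
      ∫⁻ t in Ici (0 : ℝ), ⨆ w : H,
        ENNReal.ofReal (β t * ((⟪(β t)⁻¹ • p, w⟫ - ψ w) - ⟪(β t)⁻¹ • p, z⟫)) ≠ ⊤)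
    -- x : [0,∞) → H is twice continuously differentiable (first derivative x',
    -- second derivative x'') and satisfies ẍ + γ ẋ + ∇φ(x) + β ∇ψ(x) = 0 on [0,∞)
    (hx' : ∀ t ∈ Ici (0 : ℝ), HasDerivWithinAt x (x' t) (Ici 0) t)
    (hx'' : ∀ t ∈ Ici (0 : ℝ), HasDerivWithinAt x' (x'' t) (Ici 0) t)
    (hx''cont : ContinuousOn x'' (Ici 0))
    (hode : ∀ t ∈ Ici (0 : ℝ),
      x'' t + γ • x' t + gradient φ (x t) + β t • gradient ψ (x t) = 0) :
    ∀ z : H, (ψ z = 0 ∧ ∀ y, ψ y = 0 → φ z ≤ φ y) →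
      ∃ L : ℝ, Tendsto
        (fun T => ∫ s in (0:ℝ)..T, (φ (x s) - φ z + (1 - k / γ) * (β s * ψ (x s))))
        atTop (nhds L) := by
  intro z hz
  obtain ⟨hz0, hzmin⟩ := hz
  obtain ⟨m, hm⟩ := hφbdd
  have hφm : ∀ y, m ≤ φ y := fun y => hm (mem_range_self y)
  set c : ℝ := 1 - k / γ with hc
  have hc0 : 0 < c := by
    rw [hc, sub_pos, div_lt_one hγ]; exact hkγ
  set F : ℝ → ℝ := fun s => φ (x s) - φ z + c * (β s * ψ (x s)) with hF
  have hxc : ContinuousOn x (Ici 0) := fun t ht => (hx' t ht).continuousWithinAt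
  have hβc : ContinuousOn β (Ici 0) := fun t ht => (hβderiv t ht).continuousWithinAt
  have hFc : ContinuousOn F (Ici 0) :=
    ((hφdiff.continuous.comp_continuousOn hxc).sub continuousOn_const).add
      (continuousOn_const.mul (hβc.mul (hψdiff.continuous.comp_continuousOn hxc)))
  set f : ℝ → ℝ := fun s => F (max s 0) with hf
  have hfc : Continuous f :=
    hFc.comp_continuous (by fun_prop) fun s => mem_Ici.2 (le_max_right _ _)
  have hfF : ∀ t ∈ Ici (0 : ℝ), f t = F t := fun t ht => by
    simp only [hf]; rw [max_eq_left ht]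
  -- the normal cone contains `-∇φ(z)`, which controls the negative part of `F`
  have hconv : Convex ℝ {y | ψ y = 0} := by
    have := hψconv.convex_le 0
    convert this using 1
    ext y
    simp [le_antisymm_iff, hψnonneg y]
  have hmin : IsMinOn φ {y | ψ y = 0} z := fun y hy => hzmin y hy
  have hneg : ∫⁻ t in Ici (0 : ℝ), ENNReal.ofReal (-f t) ≠ ⊤ := by
    have hp := hH z (-(c⁻¹ • gradient φ z)) hz0 fun y hy => by
      have := hmin.inner_gradient_nonneg hconv (hφdiff z) hz0 hy
      rw [inner_neg_left, real_inner_smul_left]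
      have : 0 ≤ c⁻¹ * ⟪gradient φ z, y - z⟫ := by positivity
      linarith
    refine ne_top_of_le_ne_top (ENNReal.mul_ne_top (ENNReal.ofReal_ne_top (r := c)) hp) ?_
    rw [← lintegral_const_mul' _ _ ENNReal.ofReal_ne_top]
    refine setLIntegral_mono' measurableSet_Ici fun t ht => ?_
    refine le_trans ?_ (mul_le_mul_right (le_iSup _ (x t)) _)
    rw [← ENNReal.ofReal_mul hc0.le]
    refine ENNReal.ofReal_le_ofReal ?_
    have hg := hφconv.inner_gradient_le hφdiff z (x t)
    have hb := (hβpos t ht).ne'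
    have hc' := hc0.ne'
    rw [inner_sub_right] at hg
    rw [hfF t ht]
    simp only [hF, inner_neg_left, real_inner_smul_left, smul_neg]
    have : c * (β t * (-((β t)⁻¹ * (c⁻¹ * ⟪gradient φ z, x t⟫)) - ψ (x t)
        - -((β t)⁻¹ * (c⁻¹ * ⟪gradient φ z, z⟫)))) =
        -(⟪gradient φ z, x t⟫ - ⟪gradient φ z, z⟫) - c * (β t * ψ (x t)) := by
      field_simp
      ring
    rw [this]
    linarith
  -- Lyapunov function
  set u' : ℝ → ℝ := fun t => ⟪x t - z, x' t⟫ with hu'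
  set u : ℝ → ℝ := fun t => ‖x t - z‖ ^ 2 / 2 with hu
  have hud : ∀ t ∈ Ici (0 : ℝ), HasDerivWithinAt u (u' t) (Ici 0) t := fun t ht => by
    refine (((hx' t ht).sub_const z).norm_sq.div_const 2).congr_deriv ?_
    simp [hu']
  have hud' : ∀ t ∈ Ici (0 : ℝ), HasDerivWithinAt u' (⟪x t - z, x'' t⟫ + ⟪x' t, x' t⟫) (Ici 0) t :=
    fun t ht => ((hx' t ht).sub_const z).inner ℝ (hx'' t ht)
  set E : ℝ → ℝ := fun t => ‖x' t‖ ^ 2 / 2 + φ (x t) + β t * ψ (x t) with hE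
  have hEd : ∀ t ∈ Ici (0 : ℝ),
      HasDerivWithinAt E (β' t * ψ (x t) - γ * ⟪x' t, x' t⟫) (Ici 0) t := fun t ht => by
    have h := (((hx'' t ht).norm_sq.div_const 2).add ((hx' t ht).comp_gradient (hφdiff _))).add
      ((hβderiv t ht).mul ((hx' t ht).comp_gradient (hψdiff _)))
    refine h.congr_deriv ?_
    have h0 := congrArg (fun v => ⟪v, x' t⟫) (hode t ht)
    simp only [inner_add_left, real_inner_smul_left, inner_zero_left] at h0
    rw [real_inner_comm (x'' t) (x' t)]
    linarith
  set G : ℝ → ℝ := fun t => u' t + γ * u t + E t / γ + ∫ s in (0 : ℝ)..t, f s with hG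
  have hGd : ∀ t ∈ Ici (0 : ℝ), HasDerivWithinAt G
      (⟪x t - z, x'' t⟫ + ⟪x' t, x' t⟫ + γ * u' t + (β' t * ψ (x t) - γ * ⟪x' t, x' t⟫) / γ + f t)
      (Ici 0) t := fun t ht =>
    (((hud' t ht).add ((hud t ht).const_mul γ)).add ((hEd t ht).div_const γ)).add
      (hfc.integral_hasStrictDerivAt 0 t).hasDerivAt.hasDerivWithinAt
  have hGanti : AntitoneOn G (Ici 0) := by
    refine antitoneOn_of_hasDerivWithinAt_nonpos (convex_Ici 0)
      (fun t ht => (hGd t ht).continuousWithinAt)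
      (fun t ht => (hGd t (interior_subset ht)).mono interior_subset) fun t ht' => ?_
    have ht : t ∈ Ici (0 : ℝ) := interior_subset ht'
    have h0 := congrArg (fun v => ⟪x t - z, v⟫) (hode t ht)
    simp only [inner_add_right, real_inner_smul_right, inner_zero_right] at h0
    have h1 := hφconv.inner_gradient_le hφdiff (x t) z
    have h2 := hψconv.inner_gradient_le hψdiff (x t) z
    rw [← neg_sub (x t) z, inner_neg_right, real_inner_comm] at h1 h2
    rw [hz0] at h2
    have h3 : β t * ψ (x t) ≤ β t * ⟪x t - z, gradient ψ (x t)⟫ :=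
      mul_le_mul_of_nonneg_left (by linarith) (hβpos t ht).le
    have h4 : β' t * ψ (x t) / γ ≤ k / γ * (β t * ψ (x t)) := by
      rw [div_mul_eq_mul_div, ← mul_assoc]
      exact div_le_div_of_nonneg_right
        (mul_le_mul_of_nonneg_right (hβgrowth t ht).2 (hψnonneg _)) hγ.le
    have h5 : (β' t * ψ (x t) - γ * ⟪x' t, x' t⟫) / γ =
        β' t * ψ (x t) / γ - ⟪x' t, x' t⟫ := by
      field_simp
    rw [h5, hfF t ht]
    simp only [hF, hu', hc]
    linarith
  have hint : IntegrableOn f (Ioi 0) := by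
    refine integrableOn_Ioi_of_deriv_add_integral_le (C := G 0 - m / γ) hfc hneg hud
      (fun t _ => by positivity) fun t ht => ?_
    have h1 := hGanti self_mem_Ici ht ht
    have h2 : 0 ≤ γ * u t := by positivity
    have h3 : m / γ ≤ E t / γ := by
      refine div_le_div_of_nonneg_right ?_ hγ.le
      have h4 := hφm (x t)
      have h5 := mul_nonneg (hβpos t ht).le (hψnonneg (x t))
      have h6 : 0 ≤ ‖x' t‖ ^ 2 / 2 := by positivity
      simp only [hE]
      linarith
    have h7 : G t = u' t + γ * u t + E t / γ + ∫ s in (0 : ℝ)..t, f s := rfl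
    linarith
  refine ⟨_, (intervalIntegral_tendsto_integral_Ioi 0 hint tendsto_id).congr' ?_⟩
  filter_upwards [eventually_ge_atTop 0] with T hT
  refine intervalIntegral.integral_congr fun s hs => hfF s ?_
  rw [id, uIcc_of_le hT] at hs
  exact hs.1
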